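/- Let p, q, θ ∈ ℝ, let s = cos θ + (kℓ) sin θ ∈ 𝕆, and let A₁ be the 3×3 octonionic matrix !![p, i q, k q s; −i q, p, j q; −k q s, −j q, p]. Then A₁ is Hermitian, and the vector u = (i, 0, j)ᵀ ∈ 𝕆³ satisfies the right eigenvalue equation A₁ u = u (p + ε q conj(s)) for some sign ε ∈ {1, −1}. -/

import Mathlib

noncomputable section

/-- The octonions, as the Cayley–Dickson double of the quaternions. -/
def Octonion : Type := Quaternion ℝ × Quaternion ℝ

namespace Octonion

instance : AddCommGroup Octonion :=
  inferInstanceAs (AddCommGroup (Quaternion ℝ × Quaternion ℝ))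

instance : Module ℝ Octonion :=
  inferInstanceAs (Module ℝ (Quaternion ℝ × Quaternion ℝ))

/-- Cayley–Dickson multiplication: (a,b)·(c,d) = (a c − conj(d) b, d a + b conj(c)). -/
instance : Mul Octonion :=
  ⟨fun x y => (x.1 * y.1 - star y.2 * x.2, y.2 * x.1 + x.2 * star y.1)⟩

instance : One Octonion := ⟨((1 : Quaternion ℝ), 0)⟩

/-- Octonionic conjugation: conj (a,b) = (conj a, −b). -/
def conj (x : Octonion) : Octonion := (star x.1, -x.2)

/-- Real part of an octonion. -/
def re (x : Octonion) : ℝ := x.1.re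

/-- Imaginary part of an octonion. -/
def im (x : Octonion) : Octonion := x - re x • 1

/-- Embedding of the reals into the octonions. -/
def ofReal (r : ℝ) : Octonion := (((r : ℝ) : Quaternion ℝ), 0)

/-- The squared norm |w|² (the real scalar such that w · conj w = |w|² · 1). -/
def normSq (x : Octonion) : ℝ := Quaternion.normSq x.1 + Quaternion.normSq x.2

/-- The imaginary unit i. -/
def i : Octonion := ((⟨0, 1, 0, 0⟩ : Quaternion ℝ), 0)

/-- The imaginary unit j. -/
def j : Octonion := ((⟨0, 0, 1, 0⟩ : Quaternion ℝ), 0)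

/-- The imaginary unit k. -/
def k : Octonion := ((⟨0, 0, 0, 1⟩ : Quaternion ℝ), 0)

/-- The imaginary unit ℓ. -/
def l : Octonion := ((0 : Quaternion ℝ), (1 : Quaternion ℝ))

/-- The associator [x,y,z] = (xy)z − x(yz). -/
def assoc (x y z : Octonion) : Octonion := x * y * z - x * (y * z)

/-- A Jordan matrix: a 3×3 Hermitian matrix over the octonions. -/
def IsHermitian (A : Matrix (Fin 3) (Fin 3) Octonion) : Prop :=
  ∀ p q : Fin 3, conj (A q p) = A p q

/-- The right eigenvalue equation `A v = v λ`, componentwise. -/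
def Eig (A : Matrix (Fin 3) (Fin 3) Octonion) (v : Fin 3 → Octonion) (lam : Octonion) : Prop :=
  ∀ p : Fin 3, A p 0 * v 0 + A p 1 * v 1 + A p 2 * v 2 = v p * lam

end Octonion

namespace Octonion

/-- Two octonions agree when their quaternion parts do. -/
theorem ext_parts {x y : Octonion} (h₁ : x.1 = y.1) (h₂ : x.2 = y.2) : x = y :=
  Prod.ext h₁ h₂

@[simp] theorem fst_add (x y : Octonion) : (x + y).1 = x.1 + y.1 := rfl
@[simp] theorem snd_add (x y : Octonion) : (x + y).2 = x.2 + y.2 := rfl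
@[simp] theorem fst_neg (x : Octonion) : (-x).1 = -x.1 := rfl
@[simp] theorem snd_neg (x : Octonion) : (-x).2 = -x.2 := rfl
@[simp] theorem fst_smul (r : ℝ) (x : Octonion) : (r • x).1 = r • x.1 := rfl
@[simp] theorem snd_smul (r : ℝ) (x : Octonion) : (r • x).2 = r • x.2 := rfl
@[simp] theorem fst_zero : (0 : Octonion).1 = (0 : Quaternion ℝ) := rfl
@[simp] theorem snd_zero : (0 : Octonion).2 = (0 : Quaternion ℝ) := rfl
@[simp] theorem fst_one : (1 : Octonion).1 = (1 : Quaternion ℝ) := rfl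
@[simp] theorem snd_one : (1 : Octonion).2 = (0 : Quaternion ℝ) := rfl
@[simp] theorem fst_mul (x y : Octonion) : (x * y).1 = x.1 * y.1 - star y.2 * x.2 := rfl
@[simp] theorem snd_mul (x y : Octonion) : (x * y).2 = y.2 * x.1 + x.2 * star y.1 := rfl
@[simp] theorem fst_conj (x : Octonion) : (conj x).1 = star x.1 := rfl
@[simp] theorem snd_conj (x : Octonion) : (conj x).2 = -x.2 := rfl
@[simp] theorem fst_ofReal (r : ℝ) : (ofReal r).1 = (r : Quaternion ℝ) := rfl
@[simp] theorem snd_ofReal (r : ℝ) : (ofReal r).2 = (0 : Quaternion ℝ) := rfl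
@[simp] theorem i_fst_re : i.1.re = 0 := rfl
@[simp] theorem i_fst_imI : i.1.imI = 1 := rfl
@[simp] theorem i_fst_imJ : i.1.imJ = 0 := rfl
@[simp] theorem i_fst_imK : i.1.imK = 0 := rfl
@[simp] theorem j_fst_re : j.1.re = 0 := rfl
@[simp] theorem j_fst_imI : j.1.imI = 0 := rfl
@[simp] theorem j_fst_imJ : j.1.imJ = 1 := rfl
@[simp] theorem j_fst_imK : j.1.imK = 0 := rfl
@[simp] theorem k_fst_re : k.1.re = 0 := rfl
@[simp] theorem k_fst_imI : k.1.imI = 0 := rfl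
@[simp] theorem k_fst_imJ : k.1.imJ = 0 := rfl
@[simp] theorem k_fst_imK : k.1.imK = 1 := rfl
@[simp] theorem i_snd : i.2 = (0 : Quaternion ℝ) := rfl
@[simp] theorem j_snd : j.2 = (0 : Quaternion ℝ) := rfl
@[simp] theorem k_snd : k.2 = (0 : Quaternion ℝ) := rfl
@[simp] theorem l_fst : l.1 = (0 : Quaternion ℝ) := rfl
@[simp] theorem l_snd : l.2 = (1 : Quaternion ℝ) := rfl

end Octonion

open Octonion in
/-- The matrix `A₁ = !![p, iq, kqs; −iq, p, jq; −kqs, −jq, p]` with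
`s = cos θ + kℓ sin θ` is Hermitian and admits `u = (i, 0, j)ᵀ` as an eigenvector with
right eigenvalue `p ± q conj(s)`. -/
theorem example_one_u (p q θ : ℝ) :
    IsHermitian !![ofReal p, q • i, q • (k * (Real.cos θ • 1 + Real.sin θ • (k * l)));
      -(q • i), ofReal p, q • j;
      -(q • (k * (Real.cos θ • 1 + Real.sin θ • (k * l)))), -(q • j), ofReal p] ∧
    ∃ ε : ℝ, (ε = 1 ∨ ε = -1) ∧
      Eig !![ofReal p, q • i, q • (k * (Real.cos θ • 1 + Real.sin θ • (k * l)));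
        -(q • i), ofReal p, q • j;
        -(q • (k * (Real.cos θ • 1 + Real.sin θ • (k * l)))), -(q • j), ofReal p]
        ![i, 0, j]
        (ofReal p + (ε * q) • conj (Real.cos θ • 1 + Real.sin θ • (k * l))) := by
  refine ⟨fun a b => ?_, -1, Or.inr rfl, fun a => ?_⟩
  · fin_cases a <;> fin_cases b <;> apply ext_parts <;> ext <;> simp
  · fin_cases a <;> apply ext_parts <;> ext <;>
      simp [Quaternion.re_zero, Quaternion.imI_zero, Quaternion.imJ_zero, Quaternion.imK_zero,
        Quaternion.re_one, Quaternion.imI_one, Quaternion.imJ_one, Quaternion.imK_one] <;>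
      ring
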